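/- Under the assumptions that F is cocoercive with constant τ > 0 on closed convex M, F' is Lipschitz with constant L on M, u⋆ ∈ M satisfies F u⋆ = f and u⋆ = F'(u⋆)* z with ρ = ‖z‖ and ρL < 2, and u_α ∈ M solves the regularized variational inequality ⟨F u_α + α u_α - f, v - u_α⟩ ≥ 0 for all v ∈ M, the error bound τ(1 - ρL/2)‖u_α - u⋆‖² ≤ ρ²α holds; in particular ‖u_α - u⋆‖ = O(α^{1/2}) as α → 0. -/

import Mathlib

open RealInnerProductSpace

/-- First-order Taylor estimate: if the derivative of `F` is Lipschitz with constant `L` on a convex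
set, the linearization error is at most `L / 2` times the squared distance. -/
theorem Convex.norm_sub_sub_fderiv_le_of_lipschitz {E G : Type*} [NormedAddCommGroup E]
    [NormedSpace ℝ E] [NormedAddCommGroup G] [NormedSpace ℝ G] {M : Set E} (hM : Convex ℝ M)
    {F : E → G} {F' : E → E →L[ℝ] G} (hF : ∀ u ∈ M, HasFDerivAt F (F' u) u) {L : ℝ}
    (hLip : ∀ u ∈ M, ∀ v ∈ M, ‖F' u - F' v‖ ≤ L * ‖u - v‖) {x y : E} (hx : x ∈ M) (hy : y ∈ M) :
    ‖F y - F x - F' x (y - x)‖ ≤ L / 2 * ‖y - x‖ ^ 2 := by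
  set e := y - x with he
  have hmem : ∀ t ∈ Set.Icc (0 : ℝ) 1, x + t • e ∈ M := fun t ht =>
    hM.add_smul_sub_mem hx hy ht
  have hline : ∀ t : ℝ, HasDerivAt (fun t : ℝ => x + t • e) e t := fun t => by
    simpa using ((hasDerivAt_id t).smul_const e).const_add x
  have hg : ∀ t ∈ Set.Icc (0 : ℝ) 1,
      HasDerivAt (fun t : ℝ => F (x + t • e) - F x - t • F' x e)
        (F' (x + t • e) e - F' x e) t := fun t ht => by
    have h := (hF _ (hmem t ht)).comp_hasDerivAt t (hline t)
    have h' := (hasDerivAt_id' t).smul_const (F' x e)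
    rw [one_smul] at h'
    exact (h.sub_const (F x)).sub h'
  have hB : ∀ t : ℝ, HasDerivAt (fun t : ℝ => L / 2 * ‖e‖ ^ 2 * t ^ 2) (L * ‖e‖ ^ 2 * t) t :=
    fun t => by
      refine ((hasDerivAt_pow 2 t).const_mul (L / 2 * ‖e‖ ^ 2)).congr_deriv ?_
      norm_num
      ring
  have key := image_norm_le_of_norm_deriv_right_le_deriv_boundary
    (fun t ht => (hg t ht).continuousAt.continuousWithinAt)
    (fun t ht => (hg t (Set.Ico_subset_Icc_self ht)).hasDerivWithinAt)
    (by simp) hB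
    (fun t ht => ?_) (Set.right_mem_Icc.2 (zero_le_one (α := ℝ)))
  · simpa [he] using key
  · calc ‖F' (x + t • e) e - F' x e‖ = ‖(F' (x + t • e) - F' x) e‖ := by simp
      _ ≤ ‖F' (x + t • e) - F' x‖ * ‖e‖ := ContinuousLinearMap.le_opNorm _ _
      _ ≤ L * ‖x + t • e - x‖ * ‖e‖ := by
        gcongr
        exact hLip _ (hmem t (Set.Ico_subset_Icc_self ht)) _ hx
      _ = L * ‖e‖ ^ 2 * t := by
        rw [add_sub_cancel_left, norm_smul, Real.norm_of_nonneg ht.1]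
        ring

theorem stmt_11 {H : Type*} [NormedAddCommGroup H] [InnerProductSpace ℝ H]
    [CompleteSpace H]
    (D : Set H) (hD : IsOpen D) (M : Set H) (hMD : M ⊆ D)
    (hM : IsClosed M) (hMc : Convex ℝ M)
    (F : H → H) (F' : H → H →L[ℝ] H)
    (hdiff : ∀ u ∈ D, HasFDerivAt F (F' u) u)
    (τ : ℝ) (hτ : 0 < τ)
    (hcoco : ∀ u ∈ M, ∀ v ∈ M, ⟪F u - F v, u - v⟫ ≥ τ * ‖F u - F v‖ ^ 2)
    (L : ℝ) (hL : 0 ≤ L)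
    (hLip : ∀ u ∈ M, ∀ v ∈ M, ‖F' u - F' v‖ ≤ L * ‖u - v‖)
    (ustar : H) (hustar : ustar ∈ M) (f : H) (hsol : F ustar = f)
    (z : H) (hsource : ustar = ContinuousLinearMap.adjoint (F' ustar) z)
    (ρ : ℝ) (hρ : ρ = ‖z‖) (hρL : ρ * L < 2)
    (α : ℝ) (hα : 0 < α)
    (uα : H) (huα : uα ∈ M)
    (hVI : ∀ v ∈ M, ⟪F uα + α • uα - f, v - uα⟫ ≥ 0) :
    τ * (1 - ρ * L / 2) * ‖uα - ustar‖ ^ 2 ≤ ρ ^ 2 * α := by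
  subst hsol hρ
  have hrem := hMc.norm_sub_sub_fderiv_le_of_lipschitz (fun u hu => hdiff u (hMD hu)) hLip
    hustar huα
  have hco := hcoco uα huα ustar hustar
  have hvi := hVI ustar hustar
  have hadj : ⟪ustar, uα - ustar⟫ = ⟪z, F' ustar (uα - ustar)⟫ := by
    conv_lhs => rw [hsource]
    rw [ContinuousLinearMap.adjoint_inner_left, ← hsource]
  set e := uα - ustar with he
  set d := F uα - F ustar with hd
  have hsplit : ⟪F uα + α • uα - F ustar, ustar - uα⟫
      = -⟪d, e⟫ - α * ⟪ustar, e⟫ - α * ‖e‖ ^ 2 := by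
    have h1 : F uα + α • uα - F ustar = d + α • ustar + α • e := by
      rw [hd, he, smul_sub]; abel
    rw [h1, ← neg_sub uα ustar, ← he, inner_neg_right, inner_add_left, inner_add_left,
      real_inner_smul_left, real_inner_smul_left, real_inner_self_eq_norm_sq]
    ring
  have hbound : -⟪ustar, e⟫ ≤ ‖z‖ * (‖d‖ + L / 2 * ‖e‖ ^ 2) := by
    rw [hadj]
    calc -⟪z, F' ustar e⟫ ≤ ‖z‖ * ‖F' ustar e‖ :=
          (neg_le_abs _).trans (abs_real_inner_le_norm _ _)
      _ ≤ ‖z‖ * (‖d‖ + L / 2 * ‖e‖ ^ 2) := by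
        gcongr
        calc ‖F' ustar e‖ = ‖d - (d - F' ustar e)‖ := by rw [sub_sub_cancel]
          _ ≤ ‖d‖ + ‖d - F' ustar e‖ := norm_sub_le _ _
          _ ≤ _ := by gcongr
  have hmain : τ * ‖d‖ ^ 2 + α * ((1 - ‖z‖ * L / 2) * ‖e‖ ^ 2) ≤ α * (‖z‖ * ‖d‖) := by
    have := mul_le_mul_of_nonneg_left hbound hα.le
    rw [hsplit] at hvi
    linarith
  have hmul : α * (τ * (1 - ‖z‖ * L / 2) * ‖e‖ ^ 2) ≤ α * (‖z‖ ^ 2 * α) := by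
    nlinarith [mul_le_mul_of_nonneg_left hmain hτ.le, sq_nonneg (τ * ‖d‖ - α * ‖z‖ / 2),
      sq_nonneg (α * ‖z‖)]
  exact le_of_mul_le_mul_left hmul hα
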